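/- arXiv:2506.18302 — 3 statements merged into one kernel-verified Lean document; each statement's English description precedes it below -/
import Mathlib

section
/- The tangent conjugate locus 𝔖 is a closed subset of Skew_n; equivalently, S := Skew_n ∖ 𝔖 is an open subset of Skew_n. -/
open Matrix

/-- Canonical block-diagonal form of a skew-symmetric matrix. -/
noncomputable def skewCanon (n : ℕ) (θ : Fin (n / 2) → ℝ) : Matrix (Fin n) (Fin n) ℝ :=
  Matrix.of fun i j =>
    if h : i.val = j.val + 1 ∧ j.val % 2 = 0 then
      θ ⟨j.val / 2, by obtain ⟨h1, h2⟩ := h; have := i.2; omega⟩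
    else if h' : j.val = i.val + 1 ∧ i.val % 2 = 0 then
      -θ ⟨i.val / 2, by obtain ⟨h1, h2⟩ := h'; have := j.2; omega⟩
    else 0

/-- `θ` is a vector of angles of `A`. -/
def IsAngles {n : ℕ} (A : Matrix (Fin n) (Fin n) ℝ) (θ : Fin (n / 2) → ℝ) : Prop :=
  ∃ R : Matrix (Fin n) (Fin n) ℝ, Rᵀ * R = 1 ∧ Rᵀ * A * R = skewCanon n θ

/-- The tangent conjugate locus `𝔖 ⊆ Skew_n`. -/
def conjLocus (n : ℕ) : Set (Matrix (Fin n) (Fin n) ℝ) :=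
  {A | ∃ θ : Fin (n / 2) → ℝ, IsAngles A θ ∧
    ((∃ i j : Fin (n / 2), i ≠ j ∧ ∃ l : ℤ, l ≠ 0 ∧
        (θ i + θ j = 2 * (l : ℝ) * Real.pi ∨ θ i - θ j = 2 * (l : ℝ) * Real.pi)) ∨
      (n % 2 = 1 ∧ ∃ i : Fin (n / 2), ∃ l : ℤ, l ≠ 0 ∧ θ i = 2 * (l : ℝ) * Real.pi))}

/-- The nonzero integer multiples of `2π` form a closed set. -/
theorem isClosed_nonzero_multiples_two_pi :
    IsClosed {x : ℝ | ∃ l : ℤ, l ≠ 0 ∧ x = 2 * (l : ℝ) * Real.pi} := by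
  have hc : IsClosed ((fun l : ℤ => (l : ℝ)) '' {0}ᶜ) :=
    Int.isClosedEmbedding_coe_real.isClosedMap _ (isClosed_discrete _)
  convert hc.preimage (f := fun x : ℝ => x / (2 * Real.pi)) (by fun_prop) using 1
  ext x
  simp only [Set.mem_ofPred_eq, Set.mem_preimage, Set.mem_image, Set.mem_compl_iff,
    Set.mem_singleton_iff]
  refine exists_congr fun l => and_congr_right fun _ => ?_
  rw [eq_div_iff (by positivity), eq_comm]
  ring_nf

/-- The angle vectors satisfying one of the resonance conditions of the conjugate locus. -/
def resonantAngles (n : ℕ) : Set (Fin (n / 2) → ℝ) :=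
  {θ | (∃ i j : Fin (n / 2), i ≠ j ∧ ∃ l : ℤ, l ≠ 0 ∧
        (θ i + θ j = 2 * (l : ℝ) * Real.pi ∨ θ i - θ j = 2 * (l : ℝ) * Real.pi)) ∨
      (n % 2 = 1 ∧ ∃ i : Fin (n / 2), ∃ l : ℤ, l ≠ 0 ∧ θ i = 2 * (l : ℝ) * Real.pi)}

theorem isClosed_resonantAngles (n : ℕ) : IsClosed (resonantAngles n) := by
  have hP := isClosed_nonzero_multiples_two_pi
  simp only [resonantAngles, and_or_left, exists_or, Set.ofPred_or, Set.ofPred_and,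
    Set.ofPred_exists]
  have h (f : (Fin (n / 2) → ℝ) → ℝ) (hf : Continuous f) :
      IsClosed (⋃ l : ℤ, {_θ | l ≠ 0} ∩ {θ | f θ = 2 * (l : ℝ) * Real.pi}) := by
    convert hP.preimage hf using 1
    ext θ
    simp
  refine ((isClosed_iUnion_of_finite fun i => isClosed_iUnion_of_finite fun j => ?_).union
    (isClosed_iUnion_of_finite fun i => isClosed_iUnion_of_finite fun j => ?_)).union ?_
  · exact isClosed_const.inter (h _ (by fun_prop))
  · exact isClosed_const.inter (h _ (by fun_prop))
  · exact isClosed_const.inter (isClosed_iUnion_of_finite fun i => h _ (by fun_prop))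

/-- The angles read off from the subdiagonal entries of a matrix. -/
def subdiagAngles {n : ℕ} (D : Matrix (Fin n) (Fin n) ℝ) : Fin (n / 2) → ℝ :=
  fun k => D ⟨2 * k.val + 1, by omega⟩ ⟨2 * k.val, by omega⟩

theorem subdiagAngles_skewCanon {n : ℕ} (θ : Fin (n / 2) → ℝ) :
    subdiagAngles (skewCanon n θ) = θ := by
  ext k
  simp [subdiagAngles, skewCanon]

theorem continuous_subdiagAngles {n : ℕ} :
    Continuous (subdiagAngles : Matrix (Fin n) (Fin n) ℝ → Fin (n / 2) → ℝ) :=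
  continuous_pi fun _ => continuous_id.matrix_elem _ _

theorem continuous_skewCanon (n : ℕ) : Continuous (skewCanon n) := by
  refine continuous_matrix fun i j => ?_
  simp only [skewCanon, Matrix.of_apply]
  split_ifs <;> fun_prop

theorem isClosed_image_skewCanon {n : ℕ} {T : Set (Fin (n / 2) → ℝ)} (hT : IsClosed T) :
    IsClosed (skewCanon n '' T) :=
  (Function.LeftInverse.isClosedEmbedding subdiagAngles_skewCanon continuous_subdiagAngles
    (continuous_skewCanon n)).isClosedMap _ hT

theorem isCompact_orthogonal (n : ℕ) :
    IsCompact {R : Matrix (Fin n) (Fin n) ℝ | Rᵀ * R = 1} := by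
  have hK : IsCompact (Set.univ.pi fun _ => Set.univ.pi fun _ => Set.Icc (-1) 1 :
      Set (Matrix (Fin n) (Fin n) ℝ)) :=
    isCompact_univ_pi fun _ => isCompact_univ_pi fun _ => isCompact_Icc
  refine hK.of_isClosed_subset (isClosed_eq (by fun_prop) continuous_const) ?_
  intro (R : Matrix (Fin n) (Fin n) ℝ) hR i _ j _
  have hU : R ∈ Matrix.unitaryGroup (Fin n) ℝ := by
    rw [Matrix.mem_unitaryGroup_iff', Matrix.star_eq_conjTranspose,
      Matrix.conjTranspose_eq_transpose_of_trivial]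
    exact hR
  exact abs_le.mp (entry_norm_bound_of_unitary hU i j)

/-- The tangent conjugate locus `𝔖` is a closed subset of `Skew_n`
(with its subspace topology); equivalently its complement `S` is open in `Skew_n`. -/
theorem conjLocus_isClosed (n : ℕ) :
    IsClosed (Subtype.val ⁻¹' conjLocus n :
      Set {A : Matrix (Fin n) (Fin n) ℝ // Aᵀ = -A}) := by
  refine IsClosed.preimage continuous_subtype_val ?_
  have : CompactSpace {R : Matrix (Fin n) (Fin n) ℝ | Rᵀ * R = 1} :=
    isCompact_iff_compactSpace.mp (isCompact_orthogonal n)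
  have hS := (isClosed_image_skewCanon (isClosed_resonantAngles n)).preimage
    (f := fun p : {R : Matrix (Fin n) (Fin n) ℝ | Rᵀ * R = 1} × Matrix (Fin n) (Fin n) ℝ =>
      (p.1 : Matrix (Fin n) (Fin n) ℝ)ᵀ * p.2 * p.1) (by fun_prop)
  convert isClosedMap_snd_of_compactSpace _ hS using 1
  ext A
  constructor
  · rintro ⟨θ, ⟨R, hR, hA⟩, hθ⟩
    exact ⟨(⟨R, hR⟩, A), ⟨θ, hθ, hA.symm⟩, rfl⟩
  · rintro ⟨⟨⟨R, hR⟩, A⟩, ⟨θ, hθ, hA⟩, rfl⟩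
    exact ⟨θ, ⟨R, hR, hA.symm⟩, hθ⟩
end

section
/- For n ≥ 3, the open set S := Skew_n ∖ 𝔖 has infinitely many connected components. -/
open Matrix

/-- A natural-number-indexed description of the entries of `skewCanon`. -/
noncomputable def canonEntry (φ : ℕ → ℝ) (i j : ℕ) : ℝ :=
  if i = j + 1 ∧ j % 2 = 0 then φ (j / 2)
  else if j = i + 1 ∧ i % 2 = 0 then -φ (i / 2) else 0

/-- Extension of a vector of angles by zero. -/
noncomputable def extendAngles {m : ℕ} (θ : Fin m → ℝ) (k : ℕ) : ℝ :=
  if h : k < m then θ ⟨k, h⟩ else 0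

lemma skewCanon_restrict_apply (n : ℕ) (φ : ℕ → ℝ) (i j : Fin n) :
    skewCanon n (fun k => φ k) i j = canonEntry φ i j := by
  simp only [skewCanon, canonEntry, Matrix.of_apply]
  split_ifs <;> rfl

lemma skewCanon_apply (n : ℕ) (θ : Fin (n / 2) → ℝ) (i j : Fin n) :
    skewCanon n θ i j = canonEntry (extendAngles θ) i j := by
  rw [← skewCanon_restrict_apply]
  congr 2
  funext k
  simp [extendAngles]

lemma canonEntry_add_two (φ : ℕ → ℝ) (a : ℝ) (i j : ℕ) :
    canonEntry (fun k => Nat.casesOn k a φ) (i + 2) (j + 2) = canonEntry φ i j := by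
  have hi : (i + 2) / 2 = i / 2 + 1 := by omega
  have hj : (j + 2) / 2 = j / 2 + 1 := by omega
  simp only [canonEntry, hi, hj]
  congr 1
  · simp only [eq_iff_iff]; omega
  · congr 1
    simp only [eq_iff_iff]; omega

section SpectralTheorem

variable {V : Type*} [NormedAddCommGroup V] [InnerProductSpace ℝ V] [FiniteDimensional ℝ V]

/-- A nonzero skew-adjoint operator rotates some plane. -/
lemma exists_invariant_plane (T : V →ₗ[ℝ] V) (hT : ∀ x y, inner ℝ (T x) y = -inner ℝ x (T y))
    (h0 : T ≠ 0) : ∃ (u v : V) (a : ℝ), ‖u‖ = 1 ∧ ‖v‖ = 1 ∧ inner ℝ u v = 0 ∧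
      T u = a • v ∧ T v = -a • u := by
  have hself : ∀ x, inner ℝ x (T x) = 0 := fun x => by
    have := hT x x
    rw [real_inner_comm] at this
    linarith
  have hsymm : (T ∘ₗ T).IsSymmetric := fun x y => by
    simp [hT]
  set b := hsymm.eigenvectorBasis rfl
  obtain ⟨i, hi⟩ : ∃ i, T (b i) ≠ 0 := by
    by_contra! h
    exact h0 (b.toBasis.ext fun i => by simp [h])
  set μ := hsymm.eigenvalues rfl i
  have hTT : T (T (b i)) = μ • b i := hsymm.apply_eigenvectorBasis rfl i
  have hnorm : ‖b i‖ = 1 := b.orthonormal.1 i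
  have hr : ‖T (b i)‖ ≠ 0 := norm_ne_zero_iff.2 hi
  have hμ : μ = -‖T (b i)‖ ^ 2 := by
    have := hT (b i) (T (b i))
    rw [hTT, real_inner_self_eq_norm_sq, inner_smul_right, real_inner_self_eq_norm_sq, hnorm] at this
    linarith
  refine ⟨b i, ‖T (b i)‖⁻¹ • T (b i), ‖T (b i)‖, hnorm, ?_, ?_, ?_, ?_⟩
  · rw [norm_smul, norm_inv, norm_norm, inv_mul_cancel₀ hr]
  · rw [inner_smul_right, hself, mul_zero]
  · rw [smul_smul, mul_inv_cancel₀ hr, one_smul]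
  · rw [map_smul, hTT, smul_smul, hμ]
    congr 1
    field_simp

/-- Real normal form of skew-adjoint operators. -/
theorem exists_orthonormal_canonEntry (n : ℕ) :
    ∀ {V : Type*} [NormedAddCommGroup V] [InnerProductSpace ℝ V] [FiniteDimensional ℝ V]
      (T : V →ₗ[ℝ] V), (∀ x y, inner ℝ (T x) y = -inner ℝ x (T y)) → Module.finrank ℝ V = n →
      ∃ (φ : ℕ → ℝ) (e : Fin n → V), Orthonormal ℝ e ∧
        ∀ i j, inner ℝ (e i) (T (e j)) = canonEntry φ i j := by
  induction n using Nat.strong_induction_on with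
  | _ n ih =>
  intro V _ _ _ T hT hn
  by_cases h0 : T = 0
  · subst hn
    refine ⟨0, stdOrthonormalBasis ℝ V, (stdOrthonormalBasis ℝ V).orthonormal, fun i j => ?_⟩
    simp [h0, canonEntry]
  obtain ⟨u, v, a, hu, hv, huv, hTu, hTv⟩ := exists_invariant_plane T hT h0
  have hvu : inner ℝ v u = 0 := by rw [real_inner_comm, huv]
  have huu : inner ℝ u u = 1 := by rw [real_inner_self_eq_norm_sq, hu, one_pow]
  have hvv : inner ℝ v v = 1 := by rw [real_inner_self_eq_norm_sq, hv, one_pow]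
  have hpair : Orthonormal ℝ ![u, v] := by
    rw [orthonormal_iff_ite]
    intro i j
    fin_cases i <;> fin_cases j <;> simp [hu, hv, huv, hvu]
  set P : Submodule ℝ V := Submodule.span ℝ (Set.range ![u, v]) with hP
  have hPdim : Module.finrank ℝ P = 2 := by
    simpa using finrank_span_eq_card hpair.linearIndependent
  have hsum := P.finrank_add_finrank_orthogonal
  obtain ⟨k, rfl⟩ : ∃ k, n = k + 2 := ⟨n - 2, by omega⟩
  have huP : u ∈ P := Submodule.subset_span ⟨0, rfl⟩
  have hvP : v ∈ P := Submodule.subset_span ⟨1, rfl⟩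
  let TW : Pᗮ →ₗ[ℝ] Pᗮ := Pᗮ.orthogonalProjectionOnto.toLinearMap ∘ₗ T ∘ₗ Pᗮ.subtype
  have hTW : ∀ x y : Pᗮ, inner ℝ x (TW y) = inner ℝ (x : V) (T y) := fun x y => by
    simp [TW]
  obtain ⟨φ, e, he, hφ⟩ := ih k (by omega) TW
    (fun x y => by rw [hTW, real_inner_comm, hTW, real_inner_comm, hT]) (by omega)
  have hue : ∀ i, inner ℝ u (e i : V) = 0 := fun i => (e i).2 u huP
  have hve : ∀ i, inner ℝ v (e i : V) = 0 := fun i => (e i).2 v hvP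
  have heu : ∀ i, inner ℝ (e i : V) u = 0 := fun i => by rw [real_inner_comm, hue]
  have hev : ∀ i, inner ℝ (e i : V) v = 0 := fun i => by rw [real_inner_comm, hve]
  have huT : ∀ x, inner ℝ u (T x) = -a * inner ℝ v x := fun x => by
    rw [← neg_eq_iff_eq_neg.2 (hT u x), hTu, inner_smul_left]
    simp
  have hvT : ∀ x, inner ℝ v (T x) = a * inner ℝ u x := fun x => by
    rw [← neg_eq_iff_eq_neg.2 (hT v x), hTv, inner_smul_left]
    simp
  refine ⟨fun k => Nat.casesOn k a φ,
    Fin.cons u (Fin.cons v fun i => (e i : V)), ?_, ?_⟩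
  · rw [orthonormal_iff_ite] at he ⊢
    intro i j
    refine Fin.cases ?_ (fun i => Fin.cases ?_ (fun i => ?_) i) i <;>
    refine Fin.cases ?_ (fun j => Fin.cases ?_ (fun j => ?_) j) j
    all_goals simp [huv, hvu, hue, hve, heu, hev, Fin.ext_iff, hu, hv]
    simpa [Fin.ext_iff] using he i j
  · intro i j
    refine Fin.cases ?_ (fun i => Fin.cases ?_ (fun i => ?_) i) i <;>
    refine Fin.cases ?_ (fun j => Fin.cases ?_ (fun j => ?_) j) j
    all_goals simp only [Fin.cons_zero, Fin.cons_succ, huT, hvT, hTu, hTv, inner_smul_right,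
      huu, hvv, huv, hvu, hue, hve, heu, hev, Fin.val_succ, Fin.val_zero]
    case refine_3.refine_3 => rw [canonEntry_add_two, ← hTW, hφ]
    all_goals simp [canonEntry]

end SpectralTheorem

/-- Every skew-symmetric matrix has a vector of angles. -/
theorem exists_isAngles {n : ℕ} {A : Matrix (Fin n) (Fin n) ℝ} (hA : Aᵀ = -A) :
    ∃ θ, IsAngles A θ := by
  have hdot : ∀ x y : EuclideanSpace ℝ (Fin n), inner ℝ x y = x.ofLp ⬝ᵥ y.ofLp := fun x y => by
    rw [EuclideanSpace.inner_eq_star_dotProduct, dotProduct_comm]; simp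
  obtain ⟨φ, e, he, hφ⟩ := exists_orthonormal_canonEntry n (Matrix.toEuclideanLin A)
    (fun x y => by
      rw [hdot, hdot]
      simp only [Matrix.toLpLin_apply]
      rw [dotProduct_mulVec, ← mulVec_transpose, hA, neg_mulVec, neg_dotProduct, neg_neg])
    (by simp)
  refine ⟨fun k => φ k, Matrix.of fun i j => e j i, ?_, ?_⟩
  · ext i j
    rw [orthonormal_iff_ite] at he
    rw [Matrix.one_apply, ← he i j, hdot]
    rfl
  · ext i j
    rw [skewCanon_restrict_apply, ← hφ i j, hdot, Matrix.mul_assoc]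
    rfl

section CanonicalForm

variable {n : ℕ} (θ : Fin (n / 2) → ℝ)

lemma skewCanon_mul_apply_even (M : Matrix (Fin n) (Fin n) ℝ) {i k : Fin n}
    (hi : i.val % 2 = 0) (hk : k.val = i.val + 1) (j : Fin n) :
    (skewCanon n θ * M) i j = -extendAngles θ (i / 2) * M k j := by
  rw [Matrix.mul_apply, Finset.sum_eq_single k]
  · rw [skewCanon_apply, canonEntry, if_neg (by omega), if_pos (by omega)]
  · intro l _ hl
    have : l.val ≠ k.val := fun h => hl (Fin.ext h)
    rw [skewCanon_apply, canonEntry, if_neg (by omega), if_neg (by omega), zero_mul]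
  · simp

lemma skewCanon_mul_apply_odd (M : Matrix (Fin n) (Fin n) ℝ) {i k : Fin n}
    (hk : k.val % 2 = 0) (hi : i.val = k.val + 1) (j : Fin n) :
    (skewCanon n θ * M) i j = extendAngles θ (i / 2) * M k j := by
  rw [Matrix.mul_apply, Finset.sum_eq_single k]
  · rw [skewCanon_apply, canonEntry, if_pos (by omega), show k.val / 2 = i.val / 2 by omega]
  · intro l _ hl
    have : l.val ≠ k.val := fun h => hl (Fin.ext h)
    rw [skewCanon_apply, canonEntry, if_neg (by omega), if_neg (by omega), zero_mul]
  · simp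

lemma skewCanon_mul_apply_last (M : Matrix (Fin n) (Fin n) ℝ) {i : Fin n}
    (hi : i.val % 2 = 0) (hn : i.val + 1 = n) (j : Fin n) :
    (skewCanon n θ * M) i j = 0 := by
  rw [Matrix.mul_apply]
  refine Finset.sum_eq_zero fun l _ => ?_
  have := l.2
  rw [skewCanon_apply, canonEntry, if_neg (by omega), if_neg (by omega), zero_mul]

lemma skewCanon_transpose : (skewCanon n θ)ᵀ = -skewCanon n θ := by
  ext i j
  rw [Matrix.transpose_apply, Matrix.neg_apply, skewCanon_apply, skewCanon_apply]
  simp only [canonEntry]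
  split_ifs <;> first | omega | simp

/-- The square of the canonical form is diagonal. -/
lemma skewCanon_mul_self :
    skewCanon n θ * skewCanon n θ = Matrix.diagonal fun i : Fin n => -extendAngles θ (i / 2) ^ 2 := by
  ext i j
  rw [Matrix.diagonal_apply]
  rcases Nat.mod_two_eq_zero_or_one i.val with hi | hi
  · by_cases hin : i.val + 1 < n
    · rw [skewCanon_mul_apply_even θ _ (k := ⟨i + 1, hin⟩) hi rfl, skewCanon_apply, canonEntry]
      simp only [Fin.ext_iff]
      by_cases hij : i.val = j.val
      · rw [if_pos (by omega), if_pos hij, hij]; ring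
      · rw [if_neg (by omega), if_neg (by omega), if_neg hij, mul_zero]
    · have := i.2
      rw [skewCanon_mul_apply_last θ _ hi (by omega)]
      have : extendAngles θ (i / 2) = 0 := dif_neg (by omega)
      simp [this]
  · have := i.2
    rw [skewCanon_mul_apply_odd θ _ (i := i) (k := ⟨i - 1, by omega⟩) (by simp; omega)
      (by simp; omega), skewCanon_apply, canonEntry]
    simp only [Fin.ext_iff]
    by_cases hij : i.val = j.val
    · rw [if_neg (by omega), if_pos (by omega), if_pos hij,
        show (i.val - 1) / 2 = i.val / 2 by omega]
      ring
    · rw [if_neg (by omega), if_neg (by omega), if_neg hij, mul_zero]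

lemma diag_eq_zero_of_transpose_eq_neg {M : Matrix (Fin n) (Fin n) ℝ} (hM : Mᵀ = -M)
    (i : Fin n) : M i i = 0 := by
  have := congrFun (congrFun hM i) i
  simp only [Matrix.transpose_apply, Matrix.neg_apply] at this
  linarith

lemma commutator_transpose {A M : Matrix (Fin n) (Fin n) ℝ} (hA : Aᵀ = -A) (hM : Mᵀ = -M) :
    (A * M - M * A)ᵀ = -(A * M - M * A) := by
  rw [Matrix.transpose_sub, Matrix.transpose_mul, Matrix.transpose_mul, hA, hM]
  noncomm_ring

/-- Commutators with the canonical form vanish on the diagonal blocks. -/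
lemma commutator_skewCanon_apply_eq_zero {M : Matrix (Fin n) (Fin n) ℝ} (hM : Mᵀ = -M)
    {i j : Fin n} (hij : i.val / 2 = j.val / 2) :
    (skewCanon n θ * M - M * skewCanon n θ) i j = 0 := by
  have hdiag := diag_eq_zero_of_transpose_eq_neg hM
  have key : (skewCanon n θ * M - M * skewCanon n θ) i j
      = (skewCanon n θ * M) i j - (skewCanon n θ * M) j i := by
    have : M * skewCanon n θ = (skewCanon n θ * M)ᵀ := by
      rw [Matrix.transpose_mul, skewCanon_transpose, hM, neg_mul_neg]
    rw [Matrix.sub_apply, this, Matrix.transpose_apply]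
  rcases lt_trichotomy i.val j.val with h | h | h
  · rw [key, skewCanon_mul_apply_even θ M (i := i) (k := j) (by omega) (by omega),
      skewCanon_mul_apply_odd θ M (i := j) (k := i) (by omega) (by omega), hdiag, hdiag]
    simp
  · rw [key, Fin.ext h, sub_self]
  · rw [key, skewCanon_mul_apply_even θ M (i := j) (k := i) (by omega) (by omega),
      skewCanon_mul_apply_odd θ M (i := i) (k := j) (by omega) (by omega), hdiag, hdiag]
    simp

/-- Eigenvalues of the squared commutator with a canonical form, in terms of the angles. -/
lemma eigenvalue_sq_commutator_skewCanon {X : Matrix (Fin n) (Fin n) ℝ} {c : ℝ}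
    (h : skewCanon n θ * (skewCanon n θ * X - X * skewCanon n θ)
      - (skewCanon n θ * X - X * skewCanon n θ) * skewCanon n θ = -c • X)
    {i j : Fin n} (hij : X i j ≠ 0) :
    c = (extendAngles θ (i / 2) + extendAngles θ (j / 2)) ^ 2 ∨
      c = (extendAngles θ (i / 2) - extendAngles θ (j / 2)) ^ 2 := by
  set C := skewCanon n θ with hC
  have hsq := skewCanon_mul_self θ
  rw [← hC] at hsq
  set D := Matrix.diagonal fun i : Fin n => -extendAngles θ (i / 2) ^ 2
  have e1 : D * X + X * D - (C * X * C + C * X * C) = -c • X := by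
    rw [← h, ← hsq]; noncomm_ring
  have e2 : D * (C * X * C) + (C * X * C) * D - (D * X * D + D * X * D) = -c • (C * X * C) := by
    have : C * (D * X + X * D - (C * X * C + C * X * C)) * C = -c • (C * X * C) := by
      rw [e1]; simp [Matrix.mul_assoc]
    rw [← this, ← hsq]; noncomm_ring
  have f1 := congrFun (congrFun e1 i) j
  have f2 := congrFun (congrFun e2 i) j
  simp only [D, Matrix.add_apply, Matrix.sub_apply, Matrix.smul_apply, Matrix.diagonal_mul,
    Matrix.mul_diagonal, smul_eq_mul] at f1 f2
  set Y := (C * X * C) i j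
  set a := extendAngles θ (i / 2)
  set b := extendAngles θ (j / 2)
  have : (c - (a + b) ^ 2) * (c - (a - b) ^ 2) * X i j = 0 := by
    linear_combination (c - a ^ 2 - b ^ 2) * f1 + 2 * f2
  rcases mul_eq_zero.1 this with h | h
  · rcases mul_eq_zero.1 h with h | h
    · exact Or.inl (by linarith)
    · exact Or.inr (by linarith)
  · exact absurd h hij

end CanonicalForm

/-- If `-(2πl)²` is an eigenvalue of the square of `ad A` for some `l ≠ 0`, then `A` lies in the
conjugate locus. -/
theorem mem_conjLocus_of_eigenvector {n : ℕ} {A X : Matrix (Fin n) (Fin n) ℝ} (hA : Aᵀ = -A)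
    (hX : Xᵀ = -X) (hX0 : X ≠ 0) {l : ℤ} (hl : l ≠ 0)
    (h : A * (A * X - X * A) - (A * X - X * A) * A = -(2 * (l : ℝ) * Real.pi) ^ 2 • X) :
    A ∈ conjLocus n := by
  obtain ⟨θ, R, hR, hC⟩ := exists_isAngles hA
  have hR' : R * Rᵀ = 1 := mul_eq_one_comm.1 hR
  set C := skewCanon n θ with hCdef
  have conj_mul : ∀ M N, Rᵀ * (M * N) * R = (Rᵀ * M * R) * (Rᵀ * N * R) := fun M N => by
    calc Rᵀ * (M * N) * R = Rᵀ * M * 1 * N * R := by noncomm_ring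
      _ = _ := by rw [← hR']; noncomm_ring
  set Z := Rᵀ * X * R with hZ
  have hZt : Zᵀ = -Z := by
    simp [hZ, Matrix.transpose_mul, hX, Matrix.mul_assoc]
  have hZ0 : Z ≠ 0 := fun h0 => hX0 <| by
    calc X = (R * Rᵀ) * X * (R * Rᵀ) := by rw [hR']; simp
      _ = R * Z * Rᵀ := by rw [hZ]; noncomm_ring
      _ = 0 := by rw [h0]; simp
  have heig : C * (C * Z - Z * C) - (C * Z - Z * C) * C = -(2 * (l : ℝ) * Real.pi) ^ 2 • Z := by
    rw [hZ, ← Matrix.smul_mul, ← Matrix.mul_smul, ← h]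
    simp only [Matrix.mul_sub, Matrix.sub_mul, conj_mul, hC]
  obtain ⟨i, j, hij⟩ : ∃ i j, Z i j ≠ 0 := by
    by_contra! h0
    exact hZ0 (by ext i j; exact h0 i j)
  have hc : 2 * (l : ℝ) * Real.pi ≠ 0 := by
    have : (l : ℝ) ≠ 0 := by exact_mod_cast hl
    have := Real.pi_ne_zero
    positivity
  have hblock : i.val / 2 ≠ j.val / 2 := fun hb => by
    have h0 := commutator_skewCanon_apply_eq_zero θ
      (commutator_transpose (skewCanon_transpose θ) hZt) hb
    rw [← hCdef, heig, Matrix.smul_apply, smul_eq_mul] at h0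
    rcases mul_eq_zero.1 h0 with h0 | h0
    · exact hc (by simpa using h0)
    · exact hij h0
  have hcases : ∃ l' : ℤ, l' ≠ 0 ∧
      (extendAngles θ (i / 2) + extendAngles θ (j / 2) = 2 * (l' : ℝ) * Real.pi ∨
        extendAngles θ (i / 2) - extendAngles θ (j / 2) = 2 * (l' : ℝ) * Real.pi) := by
    rcases eigenvalue_sq_commutator_skewCanon θ heig hij with h | h <;>
    rcases sq_eq_sq_iff_eq_or_eq_neg.1 h with h | h
    · exact ⟨l, hl, Or.inl h.symm⟩
    · exact ⟨-l, neg_ne_zero.2 hl, Or.inl (by push_cast; linarith)⟩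
    · exact ⟨l, hl, Or.inr h.symm⟩
    · exact ⟨-l, neg_ne_zero.2 hl, Or.inr (by push_cast; linarith)⟩
  obtain ⟨l', hl', hcases⟩ := hcases
  refine ⟨θ, ⟨R, hR, hC⟩, ?_⟩
  have hi := i.2
  have hj := j.2
  by_cases hi2 : i.val / 2 < n / 2 <;> by_cases hj2 : j.val / 2 < n / 2
  · left
    refine ⟨⟨_, hi2⟩, ⟨_, hj2⟩, by simpa using hblock, l', hl', ?_⟩
    simpa [extendAngles, hi2, hj2] using hcases
  · right
    refine ⟨by omega, ⟨_, hi2⟩, l', hl', ?_⟩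
    simpa [extendAngles, hi2, hj2] using hcases
  · right
    simp only [extendAngles, hi2, hj2, dite_true, dite_false, zero_add, zero_sub] at hcases
    rcases hcases with hcases | hcases
    · exact ⟨by omega, ⟨_, hj2⟩, l', hl', hcases⟩
    · exact ⟨by omega, ⟨_, hj2⟩, -l', neg_ne_zero.2 hl', by push_cast; linarith⟩
  · omega

/-! ### The norm of `ad A` on skew-symmetric matrices -/

/-- The squared Frobenius norm of the commutator of two matrices. -/
noncomputable def commNormSq {n : ℕ} (A X : Matrix (Fin n) (Fin n) ℝ) : ℝ :=
  ((A * X - X * A)ᵀ * (A * X - X * A)).trace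

/-- The Frobenius unit sphere of the space of skew-symmetric matrices. -/
def skewSphere (n : ℕ) : Set (Matrix (Fin n) (Fin n) ℝ) :=
  {X | Xᵀ = -X ∧ (Xᵀ * X).trace = 1}

/-- The squared operator norm of `ad A` on the space of skew-symmetric matrices. -/
noncomputable def adNormSq {n : ℕ} (A : Matrix (Fin n) (Fin n) ℝ) : ℝ :=
  sSup (commNormSq A '' skewSphere n)

section AdNorm

variable {n : ℕ}

lemma trace_transpose_mul_self_eq_sum (X : Matrix (Fin n) (Fin n) ℝ) :
    (Xᵀ * X).trace = ∑ i, ∑ j, X j i ^ 2 := by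
  simp [Matrix.trace, Matrix.mul_apply, sq]

lemma trace_transpose_mul_self_nonneg (X : Matrix (Fin n) (Fin n) ℝ) : 0 ≤ (Xᵀ * X).trace := by
  rw [trace_transpose_mul_self_eq_sum]
  positivity

lemma eq_zero_of_trace_transpose_mul_self {X : Matrix (Fin n) (Fin n) ℝ}
    (h : (Xᵀ * X).trace = 0) : X = 0 := by
  rw [trace_transpose_mul_self_eq_sum,
    Finset.sum_eq_zero_iff_of_nonneg fun i _ => by positivity] at h
  ext i j
  have := (Finset.sum_eq_zero_iff_of_nonneg fun i _ => by positivity).1 (h j (Finset.mem_univ j)) i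
    (Finset.mem_univ i)
  simpa using this

lemma trace_transpose_mul_comm (X Y : Matrix (Fin n) (Fin n) ℝ) :
    (Xᵀ * Y).trace = (Yᵀ * X).trace := by
  rw [← Matrix.trace_transpose, Matrix.transpose_mul, Matrix.transpose_transpose]

lemma isCompact_skewSphere : IsCompact (skewSphere n) := by
  have hbox : IsCompact (Set.univ.pi fun _ : Fin n => Set.univ.pi fun _ : Fin n =>
      Set.Icc (-1 : ℝ) 1) :=
    isCompact_univ_pi fun _ => isCompact_univ_pi fun _ => isCompact_Icc
  refine hbox.of_isClosed_subset ?_ ?_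
  · exact (isClosed_eq (by fun_prop) (by fun_prop)).inter (isClosed_eq (by fun_prop) (by fun_prop))
  · intro (X : Matrix (Fin n) (Fin n) ℝ) ⟨_, hX⟩ i _ j _
    rw [trace_transpose_mul_self_eq_sum] at hX
    have h1 : X i j ^ 2 ≤ ∑ i, X i j ^ 2 :=
      Finset.single_le_sum (f := fun i => X i j ^ 2) (fun _ _ => by positivity) (Finset.mem_univ i)
    have h2 : ∑ i, X i j ^ 2 ≤ ∑ j, ∑ i, X i j ^ 2 :=
      Finset.single_le_sum (f := fun j => ∑ i, X i j ^ 2) (fun _ _ => by positivity)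
        (Finset.mem_univ j)
    exact abs_le.1 (abs_le_one_iff_mul_self_le_one.2 (by nlinarith))

lemma continuous_commNormSq :
    Continuous fun p : Matrix (Fin n) (Fin n) ℝ × Matrix (Fin n) (Fin n) ℝ =>
      commNormSq p.1 p.2 := by
  unfold commNormSq
  fun_prop

lemma continuous_adNormSq : Continuous (adNormSq (n := n)) :=
  isCompact_skewSphere.continuous_sSup continuous_commNormSq

lemma commNormSq_smul_left (t : ℝ) (A X : Matrix (Fin n) (Fin n) ℝ) :
    commNormSq (t • A) X = t ^ 2 * commNormSq A X := by
  have : t • A * X - X * t • A = t • (A * X - X * A) := by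
    rw [Matrix.smul_mul, Matrix.mul_smul, smul_sub]
  rw [commNormSq, this, commNormSq, Matrix.transpose_smul, Matrix.smul_mul, Matrix.mul_smul,
    smul_smul, Matrix.trace_smul, smul_eq_mul, sq]

lemma commNormSq_smul_right (t : ℝ) (A X : Matrix (Fin n) (Fin n) ℝ) :
    commNormSq A (t • X) = t ^ 2 * commNormSq A X := by
  have : A * t • X - t • X * A = t • (A * X - X * A) := by
    rw [Matrix.smul_mul, Matrix.mul_smul, smul_sub]
  rw [commNormSq, this, commNormSq, Matrix.transpose_smul, Matrix.smul_mul, Matrix.mul_smul,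
    smul_smul, Matrix.trace_smul, smul_eq_mul, sq]

open scoped Pointwise in
lemma adNormSq_smul (t : ℝ) (A : Matrix (Fin n) (Fin n) ℝ) :
    adNormSq (t • A) = t ^ 2 * adNormSq A := by
  have : commNormSq (t • A) '' skewSphere n = t ^ 2 • (commNormSq A '' skewSphere n) := by
    rw [← Set.image_smul, Set.image_image]
    simp only [commNormSq_smul_left, smul_eq_mul]
  rw [adNormSq, this, Real.sSup_smul_of_nonneg (sq_nonneg t), smul_eq_mul, adNormSq]

lemma commNormSq_le {A X : Matrix (Fin n) (Fin n) ℝ} (hX : Xᵀ = -X) :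
    commNormSq A X ≤ adNormSq A * (Xᵀ * X).trace := by
  rcases (trace_transpose_mul_self_nonneg X).eq_or_lt' with h | h
  · rw [h, eq_zero_of_trace_transpose_mul_self h]
    simp [commNormSq]
  · set q := (Xᵀ * X).trace with hq
    have hs : (√q)⁻¹ ^ 2 = q⁻¹ := by rw [inv_pow, Real.sq_sqrt h.le]
    have hmem : (√q)⁻¹ • X ∈ skewSphere n := by
      refine ⟨by rw [Matrix.transpose_smul, hX, smul_neg], ?_⟩
      rw [Matrix.transpose_smul, Matrix.smul_mul, Matrix.mul_smul, smul_smul, Matrix.trace_smul,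
        ← sq, hs, ← hq, smul_eq_mul, inv_mul_cancel₀ h.ne']
    have hle : commNormSq A ((√q)⁻¹ • X) ≤ adNormSq A :=
      le_csSup (isCompact_skewSphere.image (continuous_commNormSq.comp
        (Continuous.prodMk_right A))).bddAbove ⟨_, hmem, rfl⟩
    rw [commNormSq_smul_right, hs, inv_mul_le_iff₀ h] at hle
    linarith

/-- The commutator with a skew-symmetric matrix is skew-adjoint. -/
lemma trace_commutator_mul {A : Matrix (Fin n) (Fin n) ℝ} (hA : Aᵀ = -A)
    (Z Y : Matrix (Fin n) (Fin n) ℝ) :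
    (Zᵀ * (A * Y - Y * A)).trace = -((A * Z - Z * A)ᵀ * Y).trace := by
  rw [Matrix.transpose_sub, Matrix.transpose_mul, Matrix.transpose_mul, hA, Matrix.mul_sub,
    Matrix.sub_mul, Matrix.trace_sub, Matrix.trace_sub, ← Matrix.mul_assoc Zᵀ Y A,
    Matrix.trace_mul_comm (Zᵀ * Y) A]
  simp only [neg_mul, mul_neg, Matrix.trace_neg, Matrix.mul_assoc]
  ring

/-- The norm of `ad A` is attained at an eigenvector of its square. -/
theorem exists_eigenvector_adNormSq {A : Matrix (Fin n) (Fin n) ℝ} (hA : Aᵀ = -A)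
    (hne : (skewSphere n).Nonempty) : ∃ X : Matrix (Fin n) (Fin n) ℝ, Xᵀ = -X ∧ X ≠ 0 ∧
      A * (A * X - X * A) - (A * X - X * A) * A = -adNormSq A • X := by
  obtain ⟨X, ⟨hX, hX1⟩, hmax⟩ := isCompact_skewSphere.exists_sSup_image_eq hne
    (continuous_commNormSq.comp (Continuous.prodMk_right A)).continuousOn
  change adNormSq A = commNormSq A X at hmax
  refine ⟨X, hX, fun h => by simp [h] at hX1, ?_⟩
  set c := adNormSq A
  set L : Matrix (Fin n) (Fin n) ℝ := A * X - X * A with hL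
  have hLt : Lᵀ = -L := commutator_transpose hA hX
  have hcrit : ∀ Y : Matrix (Fin n) (Fin n) ℝ, Yᵀ = -Y →
      (Lᵀ * (A * Y - Y * A)).trace = c * (Xᵀ * Y).trace := fun Y hY => by
    set M := A * Y - Y * A with hM
    have hquad : ∀ s : ℝ, (commNormSq A Y - c * (Yᵀ * Y).trace) * (s * s)
        + (2 * ((Lᵀ * M).trace - c * (Xᵀ * Y).trace)) * s + 0 ≤ 0 := fun s => by
      have hle := commNormSq_le (A := A) (X := X + s • Y)
        (by rw [Matrix.transpose_add, Matrix.transpose_smul, hX, hY, smul_neg, neg_add])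
      have hlin : A * (X + s • Y) - (X + s • Y) * A = L + s • M := by
        rw [hL, hM, Matrix.mul_add, Matrix.add_mul, Matrix.mul_smul, Matrix.smul_mul, smul_sub]
        abel
      have hexp : ∀ P Q : Matrix (Fin n) (Fin n) ℝ, ((P + s • Q)ᵀ * (P + s • Q)).trace
          = (Pᵀ * P).trace + 2 * s * (Pᵀ * Q).trace + s * s * (Qᵀ * Q).trace := fun P Q => by
        simp only [Matrix.transpose_add, Matrix.transpose_smul, Matrix.add_mul, Matrix.mul_add,
          Matrix.smul_mul, Matrix.mul_smul, Matrix.trace_add, Matrix.trace_smul, smul_eq_mul,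
          trace_transpose_mul_comm Q P]
        ring
      rw [commNormSq, hlin, hexp, hexp, hX1] at hle
      rw [commNormSq, ← hL] at hmax
      rw [commNormSq, ← hM]
      change _ ≤ c * _ at hle
      linarith
    have := discrim_le_zero_of_nonpos hquad
    rw [discrim] at this
    have h0 : (Lᵀ * M).trace - c * (Xᵀ * Y).trace = 0 := by
      rw [← sq_eq_zero_iff]
      nlinarith [sq_nonneg ((Lᵀ * M).trace - c * (Xᵀ * Y).trace)]
    linarith
  set W := A * L - L * A + c • X with hW
  have hWt : Wᵀ = -W := by
    rw [hW, Matrix.transpose_add, commutator_transpose hA hLt, Matrix.transpose_smul, hX, smul_neg,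
      neg_add]
  have hW0 : W = 0 := by
    apply eq_zero_of_trace_transpose_mul_self
    have h1 := hcrit W hWt
    rw [trace_commutator_mul hA] at h1
    calc (Wᵀ * W).trace = ((A * L - L * A)ᵀ * W).trace + c * (Xᵀ * W).trace := by
          conv_lhs => rw [hW, Matrix.transpose_add, Matrix.transpose_smul, ← hW, Matrix.add_mul,
            Matrix.smul_mul, Matrix.trace_add, Matrix.trace_smul, smul_eq_mul]
      _ = 0 := by linarith
  rw [neg_smul]
  exact eq_neg_of_add_eq_zero_left hW0

end AdNorm

/-! ### Matrices outside the conjugate locus -/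

/-- If `A ^ 3 = -t² A` with `t ∈ π / 2 + 2πℤ`, then `A` lies outside the conjugate locus. -/
lemma notMem_conjLocus_of_cube {n : ℕ} {A : Matrix (Fin n) (Fin n) ℝ} {t : ℝ} {k : ℤ}
    (ht : t = (4 * k + 1 : ℤ) * (Real.pi / 2)) (hA : A * A * A = -t ^ 2 • A) :
    A ∉ conjLocus n := by
  rintro ⟨θ, ⟨R, hR, hC⟩, h⟩
  have hR' : R * Rᵀ = 1 := mul_eq_one_comm.1 hR
  have hcube : skewCanon n θ * skewCanon n θ * skewCanon n θ = -t ^ 2 • skewCanon n θ := by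
    rw [← hC]
    calc Rᵀ * A * R * (Rᵀ * A * R) * (Rᵀ * A * R)
        = Rᵀ * A * (R * Rᵀ) * A * (R * Rᵀ) * A * R := by noncomm_ring
      _ = Rᵀ * (A * A * A) * R := by rw [hR']; noncomm_ring
      _ = _ := by rw [hA, Matrix.mul_smul, Matrix.smul_mul]
  have hθ : ∀ i, ∃ ε : ℤ, (ε = 0 ∨ ε = 1 ∨ ε = -1) ∧ θ i = ε * t := fun i => by
    have hi := i.2
    have h1 := congrFun (congrFun hcube ⟨2 * i + 1, by omega⟩) ⟨2 * i, by omega⟩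
    have hd : (2 * i.val + 1) / 2 = i.val := by omega
    rw [skewCanon_mul_self, Matrix.diagonal_mul, Matrix.smul_apply, skewCanon_apply] at h1
    simp [canonEntry, hd, extendAngles] at h1
    rcases h1 with h1 | h1
    · rcases sq_eq_sq_iff_eq_or_eq_neg.1 h1 with h1 | h1
      · exact ⟨1, by simp, by simpa using h1⟩
      · exact ⟨-1, by simp, by simpa using h1⟩
    · exact ⟨0, by simp, by simpa using h1⟩
  have hmul : ∀ a l : ℤ, (a : ℝ) * t = 2 * (l : ℝ) * Real.pi → a * (4 * k + 1) = 4 * l := by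
    intro a l h
    rw [ht] at h
    have : ((a * (4 * k + 1) : ℤ) : ℝ) * (Real.pi / 2) = ((4 * l : ℤ) : ℝ) * (Real.pi / 2) := by
      push_cast at h ⊢
      linarith
    exact_mod_cast mul_right_cancel₀ (by positivity) this
  rcases h with ⟨i, j, -, l, hl, h⟩ | ⟨-, i, l, hl, h⟩
  · obtain ⟨a, ha, hia⟩ := hθ i
    obtain ⟨b, hb, hjb⟩ := hθ j
    rw [hia, hjb, ← add_mul, ← sub_mul] at h
    rcases h with h | h
    · have := hmul (a + b) l (by push_cast; exact h)
      rcases ha with rfl | rfl | rfl <;> rcases hb with rfl | rfl | rfl <;> omega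
    · have := hmul (a - b) l (by push_cast; exact h)
      rcases ha with rfl | rfl | rfl <;> rcases hb with rfl | rfl | rfl <;> omega
  · obtain ⟨a, ha, hia⟩ := hθ i
    have := hmul a l (by rw [← hia]; exact h)
    rcases ha with rfl | rfl | rfl <;> omega

/-- The infinitesimal rotation of the plane spanned by two basis vectors. -/
noncomputable def planeRotation {n : ℕ} (i j : Fin n) : Matrix (Fin n) (Fin n) ℝ :=
  Matrix.single j i 1 - Matrix.single i j 1

lemma planeRotation_transpose {n : ℕ} (i j : Fin n) :
    (planeRotation i j)ᵀ = -planeRotation i j := by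
  simp [planeRotation, Matrix.transpose_single]

lemma planeRotation_cube {n : ℕ} {i j : Fin n} (hij : i ≠ j) :
    planeRotation i j * planeRotation i j * planeRotation i j = -planeRotation i j := by
  simp [planeRotation, Matrix.sub_mul, Matrix.mul_sub, hij, hij.symm]
  abel

lemma commutator_planeRotation {n : ℕ} {i j k : Fin n} (hij : i ≠ j) (hjk : j ≠ k) (hik : i ≠ k) :
    planeRotation i j * planeRotation j k - planeRotation j k * planeRotation i j
      = -planeRotation i k := by
  simp [planeRotation, Matrix.sub_mul, Matrix.mul_sub, hij, hij.symm, hjk, hjk.symm, hik, hik.symm]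

lemma planeRotation_ne_zero {n : ℕ} {i j : Fin n} (hij : i ≠ j) : planeRotation i j ≠ 0 :=
  fun h => by simpa [planeRotation, hij, hij.symm] using congrFun (congrFun h j) i

lemma adNormSq_planeRotation_pos {n : ℕ} {i j k : Fin n} (hij : i ≠ j) (hjk : j ≠ k)
    (hik : i ≠ k) : 0 < adNormSq (planeRotation i j) := by
  have hle := commNormSq_le (A := planeRotation i j) (planeRotation_transpose j k)
  have hpos : ∀ M : Matrix (Fin n) (Fin n) ℝ, M ≠ 0 → 0 < (Mᵀ * M).trace := fun M hM =>
    (trace_transpose_mul_self_nonneg M).lt_of_ne' fun h =>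
      hM (eq_zero_of_trace_transpose_mul_self h)
  rw [commNormSq, commutator_planeRotation hij hjk hik] at hle
  have h1 := hpos _ (neg_ne_zero.2 (planeRotation_ne_zero hik))
  exact pos_of_mul_pos_left (h1.trans_le hle) (hpos _ (planeRotation_ne_zero hjk)).le

/-- Off the conjugate locus, the norm of `ad A` avoids the nonzero multiples of `2π`. -/
lemma sqrt_adNormSq_ne {n : ℕ} (hne : (skewSphere n).Nonempty) {A : Matrix (Fin n) (Fin n) ℝ}
    (hA : Aᵀ = -A) (hS : A ∉ conjLocus n) {l : ℤ} (hl : l ≠ 0) :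
    √(adNormSq A) ≠ 2 * (l : ℝ) * Real.pi := fun h => by
  have hpos : 0 < √(adNormSq A) := by
    refine (Real.sqrt_nonneg _).lt_of_ne' ?_
    rw [h]
    have : (l : ℝ) ≠ 0 := by exact_mod_cast hl
    have := Real.pi_ne_zero
    positivity
  obtain ⟨X, hX, hX0, heig⟩ := exists_eigenvector_adNormSq hA hne
  rw [← Real.sq_sqrt (Real.sqrt_pos.1 hpos).le, h] at heig
  exact hS (mem_conjLocus_of_eigenvector hA hX hX0 hl heig)

/-- For `n ≥ 3`, the open set `S = Skew_n ∖ 𝔖` has infinitely many connected components. -/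
theorem complement_conjLocus_infinitely_many_components (n : ℕ) (hn : 3 ≤ n) :
    Infinite (ConnectedComponents
      {A : Matrix (Fin n) (Fin n) ℝ // Aᵀ = -A ∧ A ∉ conjLocus n}) := by
  let i₀ : Fin n := ⟨0, by omega⟩
  let i₁ : Fin n := ⟨1, by omega⟩
  let i₂ : Fin n := ⟨2, by omega⟩
  have h01 : i₀ ≠ i₁ := by simp [i₀, i₁]
  have h12 : i₁ ≠ i₂ := by simp [i₁, i₂]
  have h02 : i₀ ≠ i₂ := by simp [i₀, i₂]
  set B := planeRotation i₀ i₁ with hB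
  have hBpos : 0 < adNormSq B := adNormSq_planeRotation_pos h01 h12 h02
  have hne : (skewSphere n).Nonempty := by
    by_contra h
    rw [Set.not_nonempty_iff_eq_empty] at h
    simp [adNormSq, h] at hBpos
  set c := √(adNormSq B)
  have hc : 0 < c := Real.sqrt_pos.2 hBpos
  obtain ⟨N, hN⟩ := exists_nat_ge (1 / c)
  rw [div_le_iff₀ hc] at hN
  let t : ℕ → ℝ := fun k => (4 * (N * k : ℤ) + 1 : ℤ) * (Real.pi / 2)
  have ht : ∀ k, 0 < t k := fun k => by positivity
  let a : ℕ → {A : Matrix (Fin n) (Fin n) ℝ // Aᵀ = -A ∧ A ∉ conjLocus n} := fun k =>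
    ⟨t k • B, by rw [Matrix.transpose_smul, hB, planeRotation_transpose, smul_neg],
      notMem_conjLocus_of_cube (t := t k) rfl <| by
        simp only [Matrix.smul_mul, Matrix.mul_smul, smul_smul]
        rw [hB, planeRotation_cube h01, smul_neg, ← neg_smul]
        ring_nf⟩
  let f : {A : Matrix (Fin n) (Fin n) ℝ // Aᵀ = -A ∧ A ∉ conjLocus n} → ℝ :=
    fun A => √(adNormSq A.1)
  have hf : Continuous f := (continuous_adNormSq.comp continuous_subtype_val).sqrt
  have hfa : ∀ k, f (a k) = t k * c := fun k => by
    change √(adNormSq (t k • B)) = _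
    rw [adNormSq_smul, Real.sqrt_mul (sq_nonneg _), Real.sqrt_sq (ht k).le]
  have hsep : ∀ k k', k < k' → ConnectedComponents.mk (a k) ≠ ConnectedComponents.mk (a k') := by
    intro k k' hlt heq
    rw [ConnectedComponents.coe_eq_coe] at heq
    have hgap : f (a k) + 2 * Real.pi ≤ f (a k') := by
      rw [hfa, hfa]
      have hk : (k : ℝ) + 1 ≤ k' := by exact_mod_cast hlt
      have h1 : t k' - t k = 2 * Real.pi * (N * (k' - k)) := by
        simp only [t]; push_cast; ring
      have h2 : (1 : ℝ) ≤ N * c * (k' - k) := by nlinarith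
      nlinarith [Real.pi_pos]
    have hconn := (isPreconnected_connectedComponent (x := a k)).image f hf.continuousOn
    set l : ℤ := ⌊f (a k) / (2 * Real.pi)⌋ + 1 with hl
    have hpi : 0 < 2 * Real.pi := by positivity
    have hfk : 0 ≤ f (a k) / (2 * Real.pi) := div_nonneg (Real.sqrt_nonneg _) hpi.le
    have hl0 : l ≠ 0 := by
      have := Int.floor_nonneg.2 hfk
      omega
    have hmem : 2 * (l : ℝ) * Real.pi ∈ Set.Icc (f (a k)) (f (a k')) := by
      have h1 := Int.lt_floor_add_one (f (a k) / (2 * Real.pi))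
      have h2 := Int.floor_le (f (a k) / (2 * Real.pi))
      rw [div_lt_iff₀ hpi] at h1
      rw [le_div_iff₀ hpi] at h2
      rw [hl]
      push_cast
      constructor <;> linarith
    obtain ⟨A, -, hA⟩ := hconn.Icc_subset ⟨a k, mem_connectedComponent, rfl⟩
      ⟨a k', heq ▸ mem_connectedComponent, rfl⟩ hmem
    exact sqrt_adNormSq_ne hne A.2.1 A.2.2 hl0 hA
  refine Infinite.of_injective (fun k => ConnectedComponents.mk (a k)) fun k k' h => ?_
  rcases lt_trichotomy k k' with hlt | heq | hlt
  · exact absurd h (hsep k k' hlt)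
  · exact heq
  · exact absurd h.symm (hsep k' k hlt)
end

section
/- Let A ∈ Skew_n ∖ 𝔖 have a vector of angles Θ = (θ_1,…,θ_m), and for i ≤ m set E_i := [[cos θ_i, −sin θ_i],[sin θ_i, cos θ_i]]. Then for all i ≠ j ≤ m, E_i = E_j if and only if θ_i = θ_j. Moreover: (i) if n is odd and E_i = I₂, then θ_i = 0; (ii) if n is even and E_i = E_j = I₂ for some i ≠ j, then θ_i = θ_j = 0; (iii) if n is even and θ_i = 2lπ for some nonzero integer l, then E_j ≠ I₂ for all j ≠ i; (iv) if E_i = −I₂ (equivalently θ_i is an odd integer multiple of π), then E_j ≠ −I₂ for all j ≠ i. -/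
open Matrix

/-- Two reals with the same cosine and sine differ by an integer multiple of `2π`. -/
theorem exists_sub_eq_two_mul_int_mul_pi {a b : ℝ} (hc : Real.cos a = Real.cos b)
    (hs : Real.sin a = Real.sin b) : ∃ l : ℤ, a - b = 2 * (l : ℝ) * Real.pi := by
  obtain ⟨l, hl⟩ := Real.Angle.angle_eq_iff_two_pi_dvd_sub.1 (Real.Angle.cos_sin_inj hc hs)
  exact ⟨l, by rw [hl]; ring⟩

/-- Off the conjugate locus, distinct angles with equal cosine and sine coincide. -/
theorem IsAngles.eq_of_cos_eq_of_sin_eq {n : ℕ} {A : Matrix (Fin n) (Fin n) ℝ}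
    {θ : Fin (n / 2) → ℝ} (hθ : IsAngles A θ) (hAS : A ∉ conjLocus n) {i j : Fin (n / 2)}
    (hij : i ≠ j) (hc : Real.cos (θ i) = Real.cos (θ j)) (hs : Real.sin (θ i) = Real.sin (θ j)) :
    θ i = θ j := by
  obtain ⟨l, hl⟩ := exists_sub_eq_two_mul_int_mul_pi hc hs
  by_cases h0 : l = 0
  · subst h0
    simpa [sub_eq_zero] using hl
  · exact absurd ⟨θ, hθ, .inl ⟨i, j, hij, l, h0, .inr hl⟩⟩ hAS

/-- Off the conjugate locus, distinct angles with equal cosine and opposite sine are opposite. -/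
theorem IsAngles.eq_neg_of_cos_eq_of_sin_eq_neg {n : ℕ} {A : Matrix (Fin n) (Fin n) ℝ}
    {θ : Fin (n / 2) → ℝ} (hθ : IsAngles A θ) (hAS : A ∉ conjLocus n) {i j : Fin (n / 2)}
    (hij : i ≠ j) (hc : Real.cos (θ i) = Real.cos (θ j)) (hs : Real.sin (θ i) = -Real.sin (θ j)) :
    θ i = -θ j := by
  obtain ⟨l, hl⟩ := exists_sub_eq_two_mul_int_mul_pi (a := θ i) (b := -θ j)
    (by rw [hc, Real.cos_neg]) (by rw [hs, Real.sin_neg])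
  rw [sub_neg_eq_add] at hl
  by_cases h0 : l = 0
  · subst h0
    simpa [add_eq_zero_iff_eq_neg] using hl
  · exact absurd ⟨θ, hθ, .inl ⟨i, j, hij, l, h0, .inl hl⟩⟩ hAS

/-- Off the conjugate locus, distinct angles with equal cosine and vanishing sine are zero. -/
theorem IsAngles.eq_zero_of_cos_eq_of_sin_eq_zero {n : ℕ} {A : Matrix (Fin n) (Fin n) ℝ}
    {θ : Fin (n / 2) → ℝ} (hθ : IsAngles A θ) (hAS : A ∉ conjLocus n) {i j : Fin (n / 2)}
    (hij : i ≠ j) (hc : Real.cos (θ i) = Real.cos (θ j)) (hi : Real.sin (θ i) = 0)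
    (hj : Real.sin (θ j) = 0) : θ i = 0 ∧ θ j = 0 := by
  have h₁ := hθ.eq_of_cos_eq_of_sin_eq hAS hij hc (by rw [hi, hj])
  have h₂ := hθ.eq_neg_of_cos_eq_of_sin_eq_neg hAS hij hc (by rw [hi, hj, neg_zero])
  constructor <;> linarith

/-- Structure of the `2×2` rotation blocks `E_i = [[cos θ_i, −sin θ_i],[sin θ_i, cos θ_i]]`
of `exp(A)` for `A ∈ Skew_n ∖ 𝔖` with angles `θ`. -/
theorem rotation_blocks_of_not_conjLocus (n : ℕ) (A : Matrix (Fin n) (Fin n) ℝ)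
    (hA : Aᵀ = -A) (hAS : A ∉ conjLocus n) (θ : Fin (n / 2) → ℝ) (hθ : IsAngles A θ)
    (E : Fin (n / 2) → Matrix (Fin 2) (Fin 2) ℝ)
    (hE : ∀ i, E i = !![Real.cos (θ i), -Real.sin (θ i);
                        Real.sin (θ i), Real.cos (θ i)]) :
    (∀ i j : Fin (n / 2), i ≠ j → (E i = E j ↔ θ i = θ j)) ∧
    (n % 2 = 1 → ∀ i : Fin (n / 2), E i = 1 → θ i = 0) ∧
    (n % 2 = 0 → ∀ i j : Fin (n / 2), i ≠ j → E i = 1 → E j = 1 →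
      θ i = 0 ∧ θ j = 0) ∧
    (n % 2 = 0 → ∀ i : Fin (n / 2),
      (∃ l : ℤ, l ≠ 0 ∧ θ i = 2 * (l : ℝ) * Real.pi) →
      ∀ j : Fin (n / 2), j ≠ i → E j ≠ 1) ∧
    (∀ i : Fin (n / 2), E i = -1 → ∀ j : Fin (n / 2), j ≠ i → E j ≠ -1) := by
  have cos_sin_of_one : ∀ i, E i = 1 → Real.cos (θ i) = 1 ∧ Real.sin (θ i) = 0 := by
    intro i h
    rw [hE] at h
    exact ⟨by simpa using congrFun₂ h 0 0, by simpa using congrFun₂ h 1 0⟩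
  have cos_sin_of_neg_one : ∀ i, E i = -1 → Real.cos (θ i) = -1 ∧ Real.sin (θ i) = 0 := by
    intro i h
    rw [hE] at h
    exact ⟨by simpa using congrFun₂ h 0 0, by simpa using congrFun₂ h 1 0⟩
  have both_zero : ∀ i j, i ≠ j → E i = 1 → E j = 1 → θ i = 0 ∧ θ j = 0 := by
    intro i j hij hi hj
    obtain ⟨ci, si⟩ := cos_sin_of_one i hi
    obtain ⟨cj, sj⟩ := cos_sin_of_one j hj
    exact hθ.eq_zero_of_cos_eq_of_sin_eq_zero hAS hij (by rw [ci, cj]) si sj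
  refine ⟨fun i j hij => ⟨fun h => ?_, fun h => by rw [hE, hE, h]⟩, fun hn i hi => ?_,
    fun _ => both_zero, ?_, fun i hi j hji hj => ?_⟩
  · rw [hE, hE] at h
    exact hθ.eq_of_cos_eq_of_sin_eq hAS hij (by simpa using congrFun₂ h 0 0)
      (by simpa using congrFun₂ h 1 0)
  · obtain ⟨ci, si⟩ := cos_sin_of_one i hi
    obtain ⟨l, hl⟩ := exists_sub_eq_two_mul_int_mul_pi (a := θ i) (b := 0)
      (by rw [ci, Real.cos_zero]) (by rw [si, Real.sin_zero])
    rw [sub_zero] at hl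
    by_cases h0 : l = 0
    · simpa [h0] using hl
    · exact absurd ⟨θ, hθ, .inr ⟨hn, i, l, h0, hl⟩⟩ hAS
  · rintro - i ⟨l, hl0, hl⟩ j hji hj
    have hl' : θ i = l * (2 * Real.pi) := by rw [hl]; ring
    have hi : E i = 1 := by
      have hs : Real.sin (θ i) = 0 := by
        simpa [hl'] using Real.sin_add_int_mul_two_pi 0 l
      have hc : Real.cos (θ i) = 1 := by
        rw [hl', Real.cos_int_mul_two_pi]
      rw [hE, hs, hc, neg_zero, Matrix.one_fin_two]
    have h := (both_zero j i hji hj hi).2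
    rw [hl] at h
    simp [hl0, Real.pi_ne_zero] at h
  · obtain ⟨ci, si⟩ := cos_sin_of_neg_one i hi
    obtain ⟨cj, sj⟩ := cos_sin_of_neg_one j hj
    have h := (hθ.eq_zero_of_cos_eq_of_sin_eq_zero hAS hji (by rw [ci, cj]) sj si).2
    rw [h, Real.cos_zero] at ci
    norm_num at ci
end
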